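/- Fix natural numbers N ≥ 1 (agents), T ≥ 1 (time steps), and n ≥ 1 (state dimension). For trajectories x : Fin N → Fin (T+1) → EuclideanSpace ℝ (Fin n), a terminal reward r : EuclideanSpace ℝ (Fin n) → ℝ, and a real parameter α, define for each agent i the racing cost J_i(x) = −r(x_i(T)) + α · Σ_{t=0}^{T−1} Σ_{j ≠ i} dist(x_i(t), x_j(t))², and define the potential P(x) = −Σ_{i=0}^{N−1} r(x_i(T)) + α · Σ_{t=0}^{T−1} Σ_{i < j} dist(x_i(t), x_j(t))². Then P is an exact potential for these costs: for every agent i, every trajectory profile x, and every alternative trajectory y : Fin (T+1) → EuclideanSpace ℝ (Fin n), one has J_i(x) − J_i(x with the i-th agent's trajectory replaced by y) = P(x) − P(x with the i-th agent's trajectory replaced by y). -/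

import Mathlib

open Finset

/-- The racing cost of agent `i`:
`J_i(x) = -r(x_i(T)) + α ⬝ Σ_{t=0}^{T-1} Σ_{j ≠ i} dist(x_i(t), x_j(t))²`. -/
noncomputable def racingCost (N T n : ℕ) (r : EuclideanSpace ℝ (Fin n) → ℝ) (α : ℝ)
    (i : Fin N) (x : Fin N → Fin (T + 1) → EuclideanSpace ℝ (Fin n)) : ℝ :=
  -r (x i (Fin.last T)) +
    α * ∑ t : Fin T, ∑ j ∈ univ.filter (fun j => j ≠ i),
      dist (x i t.castSucc) (x j t.castSucc) ^ 2

/-- The racing potential: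
`P(x) = -Σ_i r(x_i(T)) + α ⬝ Σ_{t=0}^{T-1} Σ_{i < j} dist(x_i(t), x_j(t))²`. -/
noncomputable def racingPotential (N T n : ℕ) (r : EuclideanSpace ℝ (Fin n) → ℝ) (α : ℝ)
    (x : Fin N → Fin (T + 1) → EuclideanSpace ℝ (Fin n)) : ℝ :=
  -∑ i : Fin N, r (x i (Fin.last T)) +
    α * ∑ t : Fin T, ∑ i : Fin N, ∑ j ∈ univ.filter (fun j => i < j),
      dist (x i t.castSucc) (x j t.castSucc) ^ 2

/-- Splitting off the pairs containing `k` from a sum over pairs `i < j`. -/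
theorem pair_sum_split {N : ℕ} (k : Fin N) (f : Fin N → Fin N → ℝ)
    (hf : ∀ i j, f i j = f j i) :
    ∑ i : Fin N, ∑ j ∈ univ.filter (fun j => i < j), f i j =
      ∑ j ∈ univ.filter (fun j => j ≠ k), f k j +
      ∑ i : Fin N, ∑ j : Fin N, (if i < j ∧ i ≠ k ∧ j ≠ k then f i j else 0) := by
  have h1 : ∀ i j : Fin N, (if i < j then f i j else 0) =
      ((if i = k then (if k < j then f k j else 0) else 0) +
        (if j = k then (if i < k then f k i else 0) else 0)) +
      (if i < j ∧ i ≠ k ∧ j ≠ k then f i j else 0) := by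
    intro i j
    by_cases hi : i = k
    · subst hi
      by_cases hj : j = i
      · subst hj; simp
      · simp [hj]
    · by_cases hj : j = k
      · subst hj; simp [hi, hf i j]
      · simp [hi, hj]
  simp only [Finset.sum_filter]
  rw [Finset.sum_congr rfl fun i _ => Finset.sum_congr rfl fun j _ => h1 i j]
  simp only [Finset.sum_add_distrib]
  congr 1
  rw [Finset.sum_comm]
  simp only [Finset.sum_ite_eq', Finset.mem_univ, if_true]
  rw [← Finset.sum_add_distrib]
  refine Finset.sum_congr rfl fun j _ => ?_
  rcases lt_trichotomy j k with h | h | h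
  · simp [h, h.ne, h.not_gt]
  · simp [h]
  · simp [h, h.ne', h.not_gt]

/-- The racing potential is an exact potential for the racing costs. -/
theorem racingPotential_is_exact_potential
    (N T n : ℕ) (hN : 1 ≤ N) (hT : 1 ≤ T) (hn : 1 ≤ n)
    (r : EuclideanSpace ℝ (Fin n) → ℝ) (α : ℝ) :
    ∀ (i : Fin N) (x : Fin N → Fin (T + 1) → EuclideanSpace ℝ (Fin n))
      (y : Fin (T + 1) → EuclideanSpace ℝ (Fin n)),
      racingCost N T n r α i x - racingCost N T n r α i (Function.update x i y) =
        racingPotential N T n r α x - racingPotential N T n r α (Function.update x i y) := by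
  intro i x y
  have key : ∀ z : Fin N → Fin (T + 1) → EuclideanSpace ℝ (Fin n),
      racingPotential N T n r α z - racingCost N T n r α i z =
        -∑ k ∈ univ.erase i, r (z k (Fin.last T)) +
        α * ∑ t : Fin T, ∑ a : Fin N, ∑ b : Fin N, (if a < b ∧ a ≠ i ∧ b ≠ i then
          dist (z a t.castSucc) (z b t.castSucc) ^ 2 else 0) := by
    intro z
    unfold racingPotential racingCost
    have hs : ∀ t : Fin T, _ := fun t =>
      pair_sum_split i (fun a b => dist (z a t.castSucc) (z b t.castSucc) ^ 2)
        (fun a b => by rw [dist_comm])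
    rw [Finset.sum_congr rfl (fun t _ => hs t), Finset.sum_add_distrib,
      ← Finset.add_sum_erase univ (fun k => r (z k (Fin.last T))) (Finset.mem_univ i)]
    ring
  have hx := key x
  have hu := key (Function.update x i y)
  have h1 : ∑ k ∈ univ.erase i, r (Function.update x i y k (Fin.last T)) =
      ∑ k ∈ univ.erase i, r (x k (Fin.last T)) := by
    refine Finset.sum_congr rfl fun k hk => ?_
    rw [Function.update_of_ne (Finset.ne_of_mem_erase hk)]
  have h2 : ∀ (t : Fin T) (a b : Fin N), (if a < b ∧ a ≠ i ∧ b ≠ i then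
      dist (Function.update x i y a t.castSucc) (Function.update x i y b t.castSucc) ^ 2 else 0)
      = (if a < b ∧ a ≠ i ∧ b ≠ i then
          dist (x a t.castSucc) (x b t.castSucc) ^ 2 else 0) := by
    intro t a b
    split_ifs with h
    · rw [Function.update_of_ne h.2.1, Function.update_of_ne h.2.2]
    · rfl
  simp only [h2] at hu
  rw [h1] at hu
  linarith
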